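/- Fix n, m ≥ 1 with m ≥ n and A = {a_1,…,a_n}. For each ℓ, let G = ⟨A ∣ R⟩_M where R consists of m independent random relators of length ℓ. Then asymptotically almost surely as ℓ → ∞, the group G is virtually abelian. -/

import Mathlib

instance derivedSeriesNormal {G : Type*} [Group G] (k : ℕ) : (derivedSeries G k).Normal :=
  derivedSeries_normal G k

/-- The normal subgroup `N · F''` of the free group determined by the relators `R`,
where `N` is the normal closure of `R` and `F''` is the second derived subgroup. -/
def metabelianRel {n : ℕ} (R : Set (FreeGroup (Fin n))) : Subgroup (FreeGroup (Fin n)) :=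
  Subgroup.normalClosure (R ∪ (derivedSeries (FreeGroup (Fin n)) 2 : Subgroup (FreeGroup (Fin n))))

instance {n : ℕ} (R : Set (FreeGroup (Fin n))) : (metabelianRel R).Normal :=
  Subgroup.normalClosure_normal

/-- The metabelian group presented by `⟨A ∣ R⟩_M`, i.e. `F(A)/(N·F(A)'')`. -/
abbrev MetabelianPresented {n : ℕ} (R : Set (FreeGroup (Fin n))) : Type :=
  FreeGroup (Fin n) ⧸ metabelianRel R

/-- A group is virtually abelian if it has an abelian subgroup of finite index. -/
def VirtuallyAbelian (G : Type*) [Group G] : Prop :=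
  ∃ H : Subgroup G, (∀ x ∈ H, ∀ y ∈ H, x * y = y * x) ∧ H.FiniteIndex

/-- The metabelian group presented by the `m` relators of length `ℓ` encoded by `w`:
each letter of a word is a generator index in `Fin n` together with a sign (`true` for the
generator, `false` for its inverse), and the word is read off as an element of the free
group by concatenating its letters. -/
abbrev RandomMetabelian {n m ℓ : ℕ} (w : Fin m → Fin ℓ → Fin n × Bool) : Type :=
  MetabelianPresented (Set.range fun i => FreeGroup.mk (List.ofFn (w i)))


/-- The exponent vector of a letter. -/
def stepVec {n : ℕ} (a : Fin n × Bool) : Fin n → ℤ :=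
  if a.2 then Pi.single a.1 1 else -Pi.single a.1 1

/-- The exponent vector of a word. -/
def wordVec {n ℓ : ℕ} (w : Fin ℓ → Fin n × Bool) : Fin n → ℤ := ∑ t, stepVec (w t)

/-- The hom from `ℤ^n` to a commutative group determined by a family of elements. -/
def zpowHom {n : ℕ} {A : Type*} [CommGroup A] (g : Fin n → A) :
    Multiplicative (Fin n → ℤ) →* A where
  toFun x := ∏ j, g j ^ (x.toAdd j)
  map_one' := by simp
  map_mul' x y := by simp [zpow_add, Finset.prod_mul_distrib]

theorem zpowHom_single {n : ℕ} {A : Type*} [CommGroup A] (g : Fin n → A) (j : Fin n) :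
    zpowHom g (Multiplicative.ofAdd (Pi.single j 1)) = g j := by
  simp only [zpowHom, MonoidHom.coe_mk, OneHom.coe_mk, toAdd_ofAdd]
  rw [Finset.prod_eq_single j]
  · simp
  · intro b _ hb
    simp [hb]
  · simp

theorem zpowHom_step {n : ℕ} {A : Type*} [CommGroup A] (ψ : FreeGroup (Fin n) →* A)
    (a : Fin n × Bool) :
    zpowHom (fun j => ψ (FreeGroup.of j)) (Multiplicative.ofAdd (stepVec a)) =
      ψ (FreeGroup.mk [a]) := by
  obtain ⟨j, b⟩ := a
  cases b
  · have h : FreeGroup.mk [(j, false)] = (FreeGroup.of j)⁻¹ := by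
      simp [FreeGroup.of, FreeGroup.inv_mk, FreeGroup.invRev]
    rw [h, map_inv]
    simp [stepVec, zpowHom_single]
  · exact zpowHom_single (fun j => ψ (FreeGroup.of j)) j

theorem zpowHom_word {n ℓ : ℕ} {A : Type*} [CommGroup A] (ψ : FreeGroup (Fin n) →* A)
    (w : Fin ℓ → Fin n × Bool) :
    zpowHom (fun j => ψ (FreeGroup.of j)) (Multiplicative.ofAdd (wordVec w)) =
      ψ (FreeGroup.mk (List.ofFn w)) := by
  induction ℓ with
  | zero => simp [wordVec, ← FreeGroup.one_eq_mk]
  | succ k ih =>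
    have h : FreeGroup.mk (List.ofFn w) =
        FreeGroup.mk [w 0] * FreeGroup.mk (List.ofFn fun t : Fin k => w t.succ) := by
      rw [FreeGroup.mul_mk, List.ofFn_succ]; rfl
    rw [h, map_mul, ← ih, ← zpowHom_step, ← map_mul, ← ofAdd_add]
    congr 2
    simp [wordVec, Fin.sum_univ_succ]

theorem virtuallyAbelian_of_det {n m ℓ : ℕ} (w : Fin m → Fin ℓ → Fin n × Bool)
    (e : Fin n → Fin m)
    (hdet : (Matrix.of fun i => wordVec (w (e i))).det ≠ 0) :
    VirtuallyAbelian (RandomMetabelian w) := by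
  set G := RandomMetabelian w with hG
  let q : FreeGroup (Fin n) →* G := QuotientGroup.mk' _
  have hq : Function.Surjective q := QuotientGroup.mk'_surjective _
  refine ⟨derivedSeries G 1, ?_, ?_⟩
  · have h2 : derivedSeries G 2 = ⊥ := by
      rw [← map_derivedSeries_eq hq, Subgroup.map_eq_bot_iff]
      rw [QuotientGroup.ker_mk']
      exact fun x hx => Subgroup.subset_normalClosure (Or.inr hx)
    intro x hx y hy
    have : _ ∈ derivedSeries G 2 := Subgroup.commutator_mem_commutator hx hy
    rw [h2, Subgroup.mem_bot] at this
    exact commutatorElement_eq_one_iff_mul_comm.mp this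
  · let ψ : FreeGroup (Fin n) →* Abelianization G := Abelianization.of.comp q
    have hψ : Function.Surjective ψ :=
      (QuotientGroup.mk'_surjective _).comp hq
    have hrel : ∀ i, ψ (FreeGroup.mk (List.ofFn (w i))) = 1 := by
      intro i
      have : q (FreeGroup.mk (List.ofFn (w i))) = 1 := by
        refine (QuotientGroup.eq_one_iff _).mpr ?_
        exact Subgroup.subset_normalClosure (Or.inl ⟨i, rfl⟩)
      simp only [ψ, MonoidHom.comp_apply, this, map_one]
    let g : Fin n → Abelianization G := fun j => ψ (FreeGroup.of j)
    let Φ := zpowHom g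
    let M : Matrix (Fin n) (Fin n) ℤ := Matrix.of fun i => wordVec (w (e i))
    have hΦ : ∀ i, Φ (Multiplicative.ofAdd (M i)) = 1 := fun i =>
      (zpowHom_word ψ (w (e i))).trans (hrel _)
    have hΦM : ∀ x : Fin n → ℤ, Φ (Multiplicative.ofAdd (Matrix.vecMul x M)) = 1 := by
      intro x
      have : Matrix.vecMul x M = ∑ i, x i • M i := by
        ext j; simp [Matrix.vecMul, dotProduct]
      rw [this, ofAdd_sum, map_prod]
      refine Finset.prod_eq_one fun i _ => ?_
      rw [ofAdd_zsmul, map_zpow, hΦ, one_zpow]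
    have hsurj : Function.Surjective Φ := by
      have hcomp : ∀ x, ∃ y, Φ y = ψ x := by
        intro x
        obtain ⟨L, rfl⟩ : ∃ L, FreeGroup.mk L = x := ⟨x.toWord, FreeGroup.mk_toWord⟩
        refine ⟨Multiplicative.ofAdd (wordVec L.get), ?_⟩
        have := zpowHom_word ψ L.get
        rwa [List.ofFn_get] at this
      intro a
      obtain ⟨x, rfl⟩ := hψ a
      exact hcomp x
    have htors : IsMulTorsion (Abelianization G) := by
      intro a
      obtain ⟨x, rfl⟩ := hsurj a
      have hx : Φ x ^ M.det = 1 := by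
        rw [← map_zpow]
        have := hΦM (Matrix.vecMul x.toAdd M.adjugate)
        rw [Matrix.vecMul_vecMul, Matrix.adjugate_mul, Matrix.vecMul_smul, Matrix.vecMul_one] at this
        rwa [ofAdd_zsmul] at this
      rw [isOfFinOrder_iff_zpow_eq_one]
      exact ⟨_, hdet, hx⟩
    have hfg : Group.FG (Abelianization G) := Group.fg_of_surjective hψ
    have hfin : Finite (Abelianization G) := CommGroup.finite_of_fg_isMulTorsion _ htors
    have : Finite (G ⧸ commutator G) := hfin
    have := Subgroup.finiteIndex_of_finite_quotient (H := commutator G)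
    rwa [derivedSeries_one]

/-- The largest atom of a sum of `k` random signs. -/
noncomputable def midProb (k : ℕ) : ℝ := (k.choose (k / 2) : ℝ) / 2 ^ k

theorem midProb_nonneg (k : ℕ) : 0 ≤ midProb k := by unfold midProb; positivity

theorem midProb_succ_le (k : ℕ) : midProb (k + 1) ≤ midProb k := by
  unfold midProb
  have h : (k + 1).choose ((k + 1) / 2) ≤ 2 * k.choose (k / 2) := by
    rcases h : (k + 1) / 2 with _ | r
    · have := Nat.choose_pos (Nat.div_le_self k 2)
      simp; omega
    · rw [Nat.choose_succ_succ']
      have h1 := Nat.choose_le_middle r k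
      have h2 := Nat.choose_le_middle (r + 1) k
      omega
  have h' : ((k + 1).choose ((k + 1) / 2) : ℝ) ≤ 2 * k.choose (k / 2) := by exact_mod_cast h
  rw [div_le_div_iff₀ (by positivity) (by positivity), pow_succ]
  nlinarith [pow_pos (show (0 : ℝ) < 2 by norm_num) k]

theorem midProb_antitone : Antitone midProb := antitone_nat_of_succ_le midProb_succ_le

theorem centralBinom_sq_le (k : ℕ) : (2 * k + 1) * k.centralBinom ^ 2 ≤ 16 ^ k := by
  induction k with
  | zero => simp
  | succ k ih =>
    have h := Nat.succ_mul_centralBinom_succ k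
    have h2 : (k + 1) ^ 2 * ((2 * (k + 1) + 1) * (k + 1).centralBinom ^ 2) ≤
        (k + 1) ^ 2 * 16 ^ (k + 1) := by
      calc (k + 1) ^ 2 * ((2 * (k + 1) + 1) * (k + 1).centralBinom ^ 2)
          = (2 * k + 3) * ((k + 1) * (k + 1).centralBinom) ^ 2 := by ring
        _ = 4 * ((2 * k + 3) * (2 * k + 1)) * ((2 * k + 1) * k.centralBinom ^ 2) := by
            rw [h]; ring
        _ ≤ 4 * (4 * (k + 1) ^ 2) * 16 ^ k := by
            apply Nat.mul_le_mul _ ih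
            nlinarith
        _ = (k + 1) ^ 2 * 16 ^ (k + 1) := by ring
    exact Nat.le_of_mul_le_mul_left h2 (by positivity)

theorem midProb_tendsto : Filter.Tendsto midProb Filter.atTop (nhds 0) := by
  have hsq : ∀ k, midProb (2 * k) ^ 2 ≤ 1 / ((k : ℝ) + 1) := by
    intro k
    have h : ((2 * k + 1 : ℕ) : ℝ) * (k.centralBinom : ℝ) ^ 2 ≤ 16 ^ k := by
      exact_mod_cast centralBinom_sq_le k
    unfold midProb
    rw [Nat.mul_div_cancel_left k (by norm_num), ← Nat.centralBinom_eq_two_mul_choose, div_pow,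
      ← pow_mul, mul_comm (2 * k) 2, ← mul_assoc, pow_mul, div_le_div_iff₀ (by positivity) (by positivity)]
    norm_num
    push_cast at h
    nlinarith [sq_nonneg (k.centralBinom : ℝ), (Nat.cast_nonneg k : (0:ℝ) ≤ k)]
  have hanti : ∀ k, midProb k ^ 2 ≤ 1 / (((k / 2 : ℕ) : ℝ) + 1) := by
    intro k
    refine le_trans ?_ (hsq (k / 2))
    have := midProb_antitone (Nat.mul_div_le k 2)
    have := midProb_nonneg k
    gcongr
  have h1 : Filter.Tendsto (fun k : ℕ => 1 / (((k / 2 : ℕ) : ℝ) + 1)) Filter.atTop (nhds 0) :=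
    tendsto_one_div_add_atTop_nhds_zero_nat.comp (Nat.tendsto_div_const_atTop (by norm_num))
  have h2 : Filter.Tendsto (fun k => midProb k ^ 2) Filter.atTop (nhds 0) :=
    squeeze_zero (fun k => sq_nonneg _) hanti h1
  have h3 := h2.sqrt
  simpa [Real.sqrt_sq, midProb_nonneg] using h3

/-- Mixed bound: `ℓ` further letters are read, `k` signs have been collected. -/
noncomputable def mixProb (n : ℕ) : ℕ → ℕ → ℝ
  | 0, k => midProb k
  | ℓ + 1, k => (1 / n) * mixProb n ℓ (k + 1) + (1 - 1 / n) * mixProb n ℓ k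

theorem inv_bounds {n : ℕ} (hn : 1 ≤ n) : (0 : ℝ) < 1 / n ∧ (0 : ℝ) ≤ 1 - 1 / n := by
  have : (1 : ℝ) ≤ n := by exact_mod_cast hn
  refine ⟨by positivity, ?_⟩
  rw [sub_nonneg, div_le_one (by positivity)]
  exact this

theorem mixProb_nonneg {n : ℕ} (hn : 1 ≤ n) (ℓ k : ℕ) : 0 ≤ mixProb n ℓ k := by
  obtain ⟨h1, h2⟩ := inv_bounds hn
  induction ℓ generalizing k with
  | zero => exact midProb_nonneg k
  | succ ℓ ih =>
    have := ih k
    have := ih (k + 1)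
    unfold mixProb
    positivity

theorem mixProb_succ_right_le {n : ℕ} (hn : 1 ≤ n) (ℓ k : ℕ) :
    mixProb n ℓ (k + 1) ≤ mixProb n ℓ k := by
  obtain ⟨h1, h2⟩ := inv_bounds hn
  induction ℓ generalizing k with
  | zero => exact midProb_succ_le k
  | succ ℓ ih =>
    have := ih k
    have := ih (k + 1)
    unfold mixProb
    gcongr

theorem mixProb_succ_left_le {n : ℕ} (hn : 1 ≤ n) (ℓ k : ℕ) :
    mixProb n (ℓ + 1) k ≤ mixProb n ℓ k := by
  obtain ⟨h1, h2⟩ := inv_bounds hn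
  have := mixProb_succ_right_le hn ℓ k
  rw [mixProb]
  nlinarith

theorem mixProb_tendsto {n : ℕ} (hn : 1 ≤ n) :
    Filter.Tendsto (fun ℓ => mixProb n ℓ 0) Filter.atTop (nhds 0) := by
  obtain ⟨h1, h2⟩ := inv_bounds hn
  have hanti : ∀ k, Antitone (fun ℓ => mixProb n ℓ k) := fun k =>
    antitone_nat_of_succ_le fun ℓ => mixProb_succ_left_le hn ℓ k
  have hlim : ∀ k, ∃ L, Filter.Tendsto (fun ℓ => mixProb n ℓ k) Filter.atTop (nhds L) := by
    intro k
    refine ⟨_, tendsto_atTop_ciInf (hanti k) ⟨0, ?_⟩⟩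
    rintro _ ⟨ℓ, rfl⟩
    exact mixProb_nonneg hn ℓ k
  choose L hL using hlim
  have hstep : ∀ k, L (k + 1) = L k := by
    intro k
    have ha := (hL k).comp (Filter.tendsto_add_atTop_nat 1)
    have hb := ((hL (k + 1)).const_mul (1 / (n : ℝ))).add ((hL k).const_mul (1 - 1 / (n : ℝ)))
    have := tendsto_nhds_unique ha hb
    have h3 : (1 / (n : ℝ)) * (L (k + 1) - L k) = 0 := by linarith
    rcases mul_eq_zero.mp h3 with h | h
    · exact absurd h h1.ne'
    · linarith
  have hconst : ∀ k, L k = L 0 := by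
    intro k
    induction k with
    | zero => rfl
    | succ k ih => rw [hstep, ih]
  have hle : ∀ k, L 0 ≤ midProb k := by
    intro k
    rw [← hconst k]
    exact (hanti k).le_of_tendsto (hL k) 0
  have h0 : L 0 ≤ 0 := ge_of_tendsto' midProb_tendsto hle
  have h0' : 0 ≤ L 0 := ge_of_tendsto' (hL 0) fun ℓ => mixProb_nonneg hn ℓ 0
  rw [← le_antisymm h0 h0']
  exact hL 0

/-- Distribution of a sum of `k` random signs times `c`. -/
noncomputable def signDist (c : ℚ) : ℕ → ℚ → ℝ
  | 0, y => if y = 0 then 1 else 0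
  | k + 1, y => (signDist c k (y - c) + signDist c k (y + c)) / 2

theorem signDist_zero {c : ℚ} (k : ℕ) :
    ∀ y, (∀ r : ℕ, y ≠ c * (2 * r - k)) → signDist c k y = 0 := by
  induction k with
  | zero =>
    intro y hy
    have := hy 0
    simp at this
    simp [signDist, this]
  | succ k ih =>
    intro y hy
    rw [signDist, ih, ih]
    · simp
    · intro r h
      apply hy r
      push_cast
      linear_combination h
    · intro r h
      apply hy (r + 1)
      push_cast
      linear_combination h

theorem signDist_eq {c : ℚ} (hc : c ≠ 0) (k r : ℕ) :
    signDist c k (c * (2 * r - k)) = (k.choose r : ℝ) / 2 ^ k := by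
  induction k generalizing r with
  | zero =>
    rcases r with _ | r
    · simp [signDist]
    · have : ((r : ℚ) + 1) ≠ 0 := by positivity
      simp [signDist, hc, this]
  | succ k ih =>
    rw [signDist]
    have e2 : c * (2 * (r : ℚ) - ((k + 1 : ℕ) : ℚ)) + c = c * (2 * r - k) := by push_cast; ring
    rw [e2, ih]
    rcases r with _ | r
    · rw [signDist_zero]
      · simp [pow_succ]; ring
      · intro r h
        have h' : c * (2 * (r : ℚ) + 2) = 0 := by push_cast at h; linear_combination -h
        have : (2 * (r : ℚ) + 2) ≠ 0 := by positivity
        simp [hc, this] at h'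
    · have e1 : c * (2 * ((r + 1 : ℕ) : ℚ) - ((k + 1 : ℕ) : ℚ)) - c = c * (2 * r - k) := by
        push_cast; ring
      rw [e1, ih, Nat.choose_succ_succ, pow_succ]
      push_cast
      field_simp

theorem signDist_le {c : ℚ} (hc : c ≠ 0) (k : ℕ) (y : ℚ) : signDist c k y ≤ midProb k := by
  by_cases h : ∀ r : ℕ, y ≠ c * (2 * r - k)
  · rw [signDist_zero k y h]
    exact midProb_nonneg k
  · push Not at h
    obtain ⟨r, rfl⟩ := h
    rw [signDist_eq hc, midProb]
    gcongr
    exact Nat.choose_le_middle r k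

/-- The value of a letter under a functional. -/
def letVal {n : ℕ} (c : Fin n → ℚ) (a : Fin n × Bool) : ℚ := if a.2 then c a.1 else -c a.1

theorem sum_signDist_le {n : ℕ} (hn : 1 ≤ n) (c : Fin n → ℚ) (j : Fin n) (hj : c j ≠ 0)
    (ℓ k : ℕ) (x : ℚ) :
    ∑ w : Fin ℓ → Fin n × Bool, signDist (c j) k (x - ∑ t, letVal c (w t)) ≤
      (2 * n) ^ ℓ * mixProb n ℓ k := by
  induction ℓ generalizing k x with
  | zero => simpa [mixProb] using signDist_le hj k x
  | succ ℓ ih =>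
    set S : ℕ → ℚ → ℝ := fun k x =>
      ∑ w : Fin ℓ → Fin n × Bool, signDist (c j) k (x - ∑ t, letVal c (w t)) with hS
    have h1 : ∑ w : Fin (ℓ + 1) → Fin n × Bool, signDist (c j) k (x - ∑ t, letVal c (w t)) =
        ∑ a : Fin n × Bool, S k (x - letVal c a) := by
      rw [← (Fin.consEquiv fun _ => Fin n × Bool).sum_comp, Fintype.sum_prod_type]
      refine Finset.sum_congr rfl fun a _ => Finset.sum_congr rfl fun w _ => ?_
      simp [Fin.consEquiv, Fin.sum_univ_succ, sub_sub]
    have h2 : ∑ a : Fin n × Bool, S k (x - letVal c a) =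
        ∑ i : Fin n, (S k (x - c i) + S k (x + c i)) := by
      rw [Fintype.sum_prod_type]
      simp [letVal]
    have h3 : S k (x - c j) + S k (x + c j) = 2 * S (k + 1) x := by
      simp only [hS]
      rw [← Finset.sum_add_distrib, Finset.mul_sum]
      refine Finset.sum_congr rfl fun w _ => ?_
      rw [signDist, sub_right_comm, add_sub_right_comm]
      ring
    rw [h1, h2, ← Finset.add_sum_erase _ _ (Finset.mem_univ j), h3]
    have h4 : ∑ i ∈ Finset.univ.erase j, (S k (x - c i) + S k (x + c i)) ≤
        ((n : ℝ) - 1) * (2 * ((2 * n) ^ ℓ * mixProb n ℓ k)) := by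
      have := Finset.sum_le_card_nsmul (Finset.univ.erase j)
        (fun i => S k (x - c i) + S k (x + c i)) (2 * ((2 * n) ^ ℓ * mixProb n ℓ k))
        (fun i _ => by
          have := ih k (x - c i)
          have := ih k (x + c i)
          simp only [hS]
          linarith)
      rw [Finset.card_erase_of_mem (Finset.mem_univ j)] at this
      simpa [Nat.cast_sub hn] using this
    have h5 : S (k + 1) x ≤ _ := ih (k + 1) x
    have hn' : (n : ℝ) ≠ 0 := by positivity
    have h6 : (2 * (n : ℝ)) ^ (ℓ + 1) * mixProb n (ℓ + 1) k =
        2 * ((2 * n) ^ ℓ * mixProb n ℓ (k + 1)) +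
          ((n : ℝ) - 1) * (2 * ((2 * n) ^ ℓ * mixProb n ℓ k)) := by
      rw [mixProb, pow_succ]
      field_simp
    rw [h6]
    linarith

open Classical in
theorem card_words_le {n : ℕ} (hn : 1 ≤ n) (ℓ : ℕ) (V : Submodule ℚ (Fin n → ℚ)) (hV : V ≠ ⊤) :
    ((Finset.univ.filter fun w : Fin ℓ → Fin n × Bool =>
      (fun i => (wordVec w i : ℚ)) ∈ V).card : ℝ) ≤ (2 * n) ^ ℓ * mixProb n ℓ 0 := by
  obtain ⟨f, hf0, hf⟩ := Submodule.exists_le_ker_of_lt_top V (lt_top_iff_ne_top.mpr hV)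
  set c : Fin n → ℚ := fun i => f (Pi.single i 1) with hc
  have hfx : ∀ x : Fin n → ℚ, f x = ∑ i, x i * c i := by
    intro x
    conv_lhs => rw [pi_eq_sum_univ' x, map_sum]
    refine Finset.sum_congr rfl fun i _ => ?_
    rw [map_smul, smul_eq_mul, hc]
  obtain ⟨j, hj⟩ : ∃ j, c j ≠ 0 := by
    by_contra h
    push Not at h
    apply hf0
    ext x
    simpa [hc] using h _
  have hval : ∀ w : Fin ℓ → Fin n × Bool,
      f (fun i => (wordVec w i : ℚ)) = ∑ t, letVal c (w t) := by
    intro w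
    rw [hfx]
    simp only [wordVec, Finset.sum_apply, Int.cast_sum, Finset.sum_mul]
    rw [Finset.sum_comm]
    refine Finset.sum_congr rfl fun t _ => ?_
    rcases w t with ⟨i, b⟩
    cases b <;> simp [stepVec, letVal, Pi.single_apply]
  refine le_trans ?_ (sum_signDist_le hn c j hj ℓ 0 0)
  rw [Finset.card_eq_sum_ones, Nat.cast_sum, Finset.sum_filter]
  refine Finset.sum_le_sum fun w _ => ?_
  simp only [signDist]
  split_ifs with h1 h2
  · simp
  · exfalso
    apply h2
    rw [← hval, LinearMap.mem_ker.mp (hf h1), sub_zero]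
  · simp
  · simp

open Classical in
theorem card_fiber_le {ι W : Type*} [Fintype ι] [DecidableEq ι] [Fintype W] (k : ι)
    (P : (ι → W) → Prop) (D : ℝ)
    (h : ∀ w, ((Finset.univ.filter fun x => P (Function.update w k x)).card : ℝ) ≤ D) :
    ((Finset.univ.filter P).card : ℝ) * Fintype.card W ≤ D * Fintype.card (ι → W) := by
  let e : (ι → W) × W ≃ (ι → W) × W :=
    { toFun := fun p => (Function.update p.1 k p.2, p.1 k)
      invFun := fun p => (Function.update p.1 k p.2, p.1 k)
      left_inv := fun p => by simp
      right_inv := fun p => by simp }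
  have h1 : ((Finset.univ.filter P).card : ℝ) * Fintype.card W =
      ∑ p : (ι → W) × W, if P p.1 then (1 : ℝ) else 0 := by
    rw [Fintype.sum_prod_type]
    rw [← Finset.sum_boole, Finset.sum_mul]
    refine Finset.sum_congr rfl fun w _ => ?_
    by_cases hw : P w <;> simp [hw]
  have h2 : ∑ p : (ι → W) × W, (if P p.1 then (1 : ℝ) else 0) =
      ∑ w : ι → W, ((Finset.univ.filter fun x => P (Function.update w k x)).card : ℝ) := by
    rw [← e.sum_comp, Fintype.sum_prod_type]
    refine Finset.sum_congr rfl fun w _ => ?_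
    simp [e]
  rw [h1, h2]
  refine (Finset.sum_le_card_nsmul _ _ D fun w _ => h w).trans ?_
  simp [mul_comm]

theorem linearIndependent_of_prev {K V : Type*} [Field K] [AddCommGroup V] [Module K V] (n : ℕ)
    (v : Fin n → V) (h : ∀ k, v k ∉ Submodule.span K (v '' Set.Iio k)) :
    LinearIndependent K v := by
  induction n with
  | zero => exact linearIndependent_empty_type
  | succ n ih =>
    rw [linearIndependent_finSucc']
    constructor
    · apply ih
      intro k hk
      apply h k.castSucc
      refine Submodule.span_mono ?_ hk
      rintro _ ⟨i, hi, rfl⟩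
      exact ⟨i.castSucc, by simpa using hi, rfl⟩
    · intro hk
      apply h (Fin.last n)
      refine Submodule.span_mono ?_ hk
      rintro _ ⟨i, rfl⟩
      exact ⟨i.castSucc, by simp, rfl⟩

/-- Rational version of the exponent vector. -/
def wordVecQ {n ℓ : ℕ} (w : Fin ℓ → Fin n × Bool) : Fin n → ℚ := fun i => (wordVec w i : ℚ)

theorem virtuallyAbelian_of_prev {n m ℓ : ℕ} (hnm : n ≤ m) (w : Fin m → Fin ℓ → Fin n × Bool)
    (h : ∀ k : Fin n, wordVecQ (w (Fin.castLE hnm k)) ∉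
      Submodule.span ℚ ((fun i : Fin n => wordVecQ (w (Fin.castLE hnm i))) '' Set.Iio k)) :
    VirtuallyAbelian (RandomMetabelian w) := by
  apply virtuallyAbelian_of_det w (Fin.castLE hnm)
  have hli := linearIndependent_of_prev (K := ℚ) n _ h
  set M : Matrix (Fin n) (Fin n) ℤ := Matrix.of fun i => wordVec (w (Fin.castLE hnm i)) with hM
  have hrow : LinearIndependent ℚ (M.map (Int.castRingHom ℚ)).row := hli
  rw [Matrix.linearIndependent_rows_iff_isUnit, Matrix.isUnit_iff_isUnit_det] at hrow
  intro h0
  have h1 := RingHom.map_det (Int.castRingHom ℚ) M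
  rw [RingHom.mapMatrix_apply] at h1
  rw [← h1, h0] at hrow
  simp at hrow

open Classical in
theorem card_bad_le {n m : ℕ} (hn : 1 ≤ n) (hnm : n ≤ m) (ℓ : ℕ) (k : Fin n) :
    ((Finset.univ.filter fun w : Fin m → Fin ℓ → Fin n × Bool =>
      wordVecQ (w (Fin.castLE hnm k)) ∈
      Submodule.span ℚ ((fun i : Fin n => wordVecQ (w (Fin.castLE hnm i))) '' Set.Iio k)).card : ℝ)
      ≤ mixProb n ℓ 0 * Fintype.card (Fin m → Fin ℓ → Fin n × Bool) := by
  have hW : (Fintype.card (Fin ℓ → Fin n × Bool) : ℝ) = (2 * n) ^ ℓ := by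
    simp [mul_comm]
  have hpos : (0 : ℝ) < (2 * n) ^ ℓ := by
    have : 0 < (n : ℝ) := by exact_mod_cast hn
    positivity
  have key := card_fiber_le (W := Fin ℓ → Fin n × Bool) (Fin.castLE hnm k)
    (fun w : Fin m → Fin ℓ → Fin n × Bool => wordVecQ (w (Fin.castLE hnm k)) ∈
      Submodule.span ℚ ((fun i : Fin n => wordVecQ (w (Fin.castLE hnm i))) '' Set.Iio k))
    ((2 * n) ^ ℓ * mixProb n ℓ 0) ?_
  · rw [hW, mul_comm ((2 * (n : ℝ)) ^ ℓ), mul_right_comm] at key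
    exact le_of_mul_le_mul_right key hpos
  · intro w
    have hset : ∀ x, (fun i : Fin n => wordVecQ (Function.update w (Fin.castLE hnm k) x
        (Fin.castLE hnm i))) '' Set.Iio k =
        (fun i : Fin n => wordVecQ (w (Fin.castLE hnm i))) '' Set.Iio k := by
      intro x
      refine Set.image_congr fun i hi => ?_
      rw [Function.update_of_ne]
      intro h
      exact (ne_of_lt hi) (Fin.castLE_injective hnm h)
    simp only [hset, Function.update_self]
    refine card_words_le hn ℓ _ ?_
    intro htop
    have h1 := finrank_span_finset_le_card (R := ℚ)
      ((Finset.Iio k).image (fun i : Fin n => wordVecQ (w (Fin.castLE hnm i))))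
    rw [Finset.coe_image, Finset.coe_Iio] at h1
    unfold Set.finrank at h1
    rw [htop, finrank_top, Module.finrank_fin_fun] at h1
    have h2 := h1.trans Finset.card_image_le
    rw [Fin.card_Iio] at h2
    have := k.2
    omega

/-- If `m ≥ n`, then asymptotically almost surely as `ℓ → ∞`, a random
`m`-relator metabelian group on `n` generators is virtually abelian. -/
theorem random_metabelian_virtually_abelian {n m : ℕ} (hn : 1 ≤ n) (hm : 1 ≤ m)
    (hnm : n ≤ m) :
    Filter.Tendsto (fun ℓ : ℕ =>
      (Nat.card {w : Fin m → Fin ℓ → Fin n × Bool //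
          VirtuallyAbelian (RandomMetabelian w)} : ℝ) /
        (Nat.card (Fin m → Fin ℓ → Fin n × Bool) : ℝ))
      Filter.atTop (nhds 1) := by
  classical
  have hlow : Filter.Tendsto (fun ℓ : ℕ => 1 - n * mixProb n ℓ 0) Filter.atTop (nhds 1) := by
    simpa using ((mixProb_tendsto hn).const_mul (n : ℝ)).const_sub 1
  refine tendsto_of_tendsto_of_tendsto_of_le_of_le hlow tendsto_const_nhds ?_ ?_
  · intro ℓ
    have : Nonempty (Fin n) := ⟨⟨0, hn⟩⟩
    have hT : (0 : ℝ) < Fintype.card (Fin m → Fin ℓ → Fin n × Bool) := by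
      exact_mod_cast Fintype.card_pos
    simp only [Nat.card_eq_fintype_card]
    rw [le_div_iff₀ hT, Fintype.card_subtype]
    have hcompl := Finset.card_filter_add_card_filter_not (s := Finset.univ)
      (fun w : Fin m → Fin ℓ → Fin n × Bool => VirtuallyAbelian (RandomMetabelian w))
    have hbad : ((Finset.univ.filter fun w : Fin m → Fin ℓ → Fin n × Bool =>
        ¬ VirtuallyAbelian (RandomMetabelian w)).card : ℝ) ≤
        n * (mixProb n ℓ 0 * Fintype.card (Fin m → Fin ℓ → Fin n × Bool)) := by
      have hsub : (Finset.univ.filter fun w : Fin m → Fin ℓ → Fin n × Bool =>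
          ¬ VirtuallyAbelian (RandomMetabelian w)) ⊆
          Finset.univ.biUnion fun k : Fin n =>
            Finset.univ.filter fun w : Fin m → Fin ℓ → Fin n × Bool =>
              wordVecQ (w (Fin.castLE hnm k)) ∈ Submodule.span ℚ
                ((fun i : Fin n => wordVecQ (w (Fin.castLE hnm i))) '' Set.Iio k) := by
        intro w hw
        simp only [Finset.mem_filter, Finset.mem_univ, true_and] at hw
        simp only [Finset.mem_biUnion, Finset.mem_filter, Finset.mem_univ, true_and]
        by_contra hcon
        push Not at hcon
        exact hw (virtuallyAbelian_of_prev hnm w hcon)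
      have h1 := (Finset.card_le_card hsub).trans Finset.card_biUnion_le
      have h2 := (Nat.cast_le (α := ℝ)).mpr h1
      refine h2.trans ?_
      rw [Nat.cast_sum]
      refine (Finset.sum_le_card_nsmul _ _ _ fun k _ => card_bad_le hn hnm ℓ k).trans ?_
      simp
    have hcompl' := congrArg (Nat.cast : ℕ → ℝ) hcompl
    rw [Finset.card_univ] at hcompl'
    rw [Nat.cast_add] at hcompl'
    linarith
  · intro ℓ
    refine div_le_one_of_le₀ ?_ (by positivity)
    exact Nat.cast_le.mpr (Finite.card_subtype_le _)
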